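/- The operation | is representable by an identity-respecting symmetric pseudo-distance d : U × U → Z if and only if | satisfies conditions (|1), (|2), and the Loop condition (|S1). -/

import Mathlib

/-- The set of elements of `B` closest to `A` under the pseudo-distance `d`. -/
def distRev {U Z : Type*} [LinearOrder Z] (d : U → U → Z) (A B : Set U) : Set U :=
  {b | b ∈ B ∧ ∃ a ∈ A, ∀ a' ∈ A, ∀ b' ∈ B, d a b ≤ d a' b'}

/-- The Loop condition (|S1). -/
def LoopCond {U : Type*} (Y : Set (Set U)) (op : Set U → Set U → Set U) : Prop :=
  ∀ (k : ℕ) (X : ℕ → Set U), 1 ≤ k → (∀ i ≤ k, X i ∈ Y) →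
    (∀ i, 1 ≤ i → i < k → ((op (X i) (X (i - 1) ∪ X (i + 1))) ∩ X (i - 1)).Nonempty) →
    ((op (X k) (X (k - 1) ∪ X 0)) ∩ X (k - 1)).Nonempty →
    ((op (X 0) (X k ∪ X 1)) ∩ X 1).Nonempty

/-- Every preorder maps monotonically to a linear order so that only equivalent elements are
identified. -/
theorem exists_linearOrder_extension.{u} {α : Type u} (r : α → α → Prop) (hrefl : ∀ x, r x x)
    (htrans : ∀ x y z, r x y → r y z → r x z) :
    ∃ (Z : Type u) (_ : LinearOrder Z) (f : α → Z), Function.Surjective f ∧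
      (∀ x y, r x y → f x ≤ f y) ∧ ∀ x y, f x = f y → r x y := by
  let _ : Preorder α := { le := r, le_refl := hrefl, le_trans := htrans }
  refine ⟨LinearExtension (Antisymmetrization α (· ≤ ·)), inferInstance,
    fun x => toLinearExtension (toAntisymmetrization (· ≤ ·) x), ?_, ?_, ?_⟩
  · exact Quotient.exists_rep
  · intro x y h
    exact toLinearExtension.monotone (toAntisymmetrization_le_toAntisymmetrization_iff.2 h)
  · intro x y h
    exact (Quotient.exact (s := AntisymmRel.setoid α (· ≤ ·)) h).1

theorem Relation.ReflTransGen.exists_seq {α : Type*} {r : α → α → Prop} {a b : α}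
    (h : Relation.ReflTransGen r a b) :
    ∃ (n : ℕ) (f : ℕ → α), f 0 = a ∧ f n = b ∧ ∀ i < n, r (f i) (f (i + 1)) := by
  induction h using Relation.ReflTransGen.head_induction_on with
  | refl => exact ⟨0, fun _ => b, rfl, rfl, by simp⟩
  | @head a c hac _ ih =>
    obtain ⟨n, f, h0, hn, hf⟩ := ih
    refine ⟨n + 1, fun i => Nat.casesOn i a f, rfl, hn, ?_⟩
    rintro (_ | i) hi
    · simpa [h0] using hac
    · exact hf i (by omega)

/-- If each pair of consecutive sets in a sequence is at most as far apart as the next pair, the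
first distance is attained and bounds the last one. -/
theorem exists_closest_of_chain {U Z : Type*} [LinearOrder Z] {d : U → U → Z}
    (hsymm : ∀ a b, d a b = d b a) (W : ℕ → Set U) (m : ℕ)
    (h : ∀ i ≤ m, (distRev d (W (i + 1)) (W i ∪ W (i + 2)) ∩ W i).Nonempty) :
    ∃ x ∈ W 0, ∃ y ∈ W 1, (∀ y' ∈ W 1, ∀ x' ∈ W 0, d y x ≤ d y' x') ∧
      ∀ y' ∈ W (m + 1), ∀ x' ∈ W (m + 2), d y x ≤ d y' x' := by
  induction m with
  | zero =>
    obtain ⟨x, ⟨_, y, hy, hmin⟩, hx⟩ := h 0 le_rfl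
    exact ⟨x, hx, y, hy, fun y' hy' x' hx' => hmin y' hy' x' (Or.inl hx'),
      fun y' hy' x' hx' => hmin y' hy' x' (Or.inr hx')⟩
  | succ m ih =>
    obtain ⟨x, hx, y, hy, hfirst, hlast⟩ := ih fun i hi => h i (by omega)
    obtain ⟨u, ⟨_, v, hv, hmin⟩, hu⟩ := h (m + 1) le_rfl
    refine ⟨x, hx, y, hy, hfirst, fun y' hy' x' hx' => ?_⟩
    exact ((hlast u hu v hv).trans_eq (hsymm u v)).trans (hmin y' hy' x' (Or.inr hx'))

theorem loopCond_of_representable {U Z : Type*} [LinearOrder Z] {Y : Set (Set U)}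
    (hYunion : ∀ A ∈ Y, ∀ B ∈ Y, A ∪ B ∈ Y) {op : Set U → Set U → Set U} {d : U → U → Z}
    (hsymm : ∀ a b, d a b = d b a) (hrep : ∀ A ∈ Y, ∀ B ∈ Y, op A B = distRev d A B) :
    LoopCond Y op := by
  intro k X hk hX hmid hlast
  obtain ⟨m, rfl⟩ : ∃ m, k = m + 1 := ⟨k - 1, by omega⟩
  let W : ℕ → Set U := fun i => if i ≤ m + 1 then X i else X 0
  have hW : ∀ i ≤ m + 1, W i = X i := fun i hi => if_pos hi
  have hWend : W (m + 2) = X 0 := if_neg (by omega)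
  obtain ⟨x, hx, y, hy, hfirst, hend⟩ := exists_closest_of_chain hsymm W m (by
    intro i hi
    rw [hW i (by omega), hW (i + 1) (by omega)]
    rcases hi.lt_or_eq with hi | rfl
    · rw [hW (i + 2) (by omega), ← hrep _ (hX _ (by omega)) _
        (hYunion _ (hX _ (by omega)) _ (hX _ (by omega)))]
      exact hmid (i + 1) (by omega) (by omega)
    · rw [hWend, ← hrep _ (hX _ (by omega)) _
        (hYunion _ (hX _ (by omega)) _ (hX _ (by omega)))]
      exact hlast)
  rw [hW 0 (by omega)] at hx hfirst
  rw [hW 1 (by omega)] at hy hfirst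
  rw [hWend, hW _ le_rfl] at hend
  rw [hrep _ (hX _ (by omega)) _ (hYunion _ (hX _ (by omega)) _ (hX _ (by omega)))]
  refine ⟨y, ⟨Or.inr hy, x, hx, ?_⟩, hy⟩
  rintro x' hx' y' (hy' | hy')
  · rw [hsymm x y, hsymm x' y']
    exact hend y' hy' x' hx'
  · rw [hsymm x y, hsymm x' y']
    exact hfirst y' hy' x' hx'

theorem distRev_eq_inter {U Z : Type*} [LinearOrder Z] {d : U → U → Z} {z0 : Z}
    (hz : ∀ z, z0 ≤ z) (hd : ∀ a b, d a b = z0 ↔ a = b) {A B : Set U} (h : (A ∩ B).Nonempty) :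
    distRev d A B = A ∩ B := by
  ext b
  constructor
  · rintro ⟨hb, a, ha, hmin⟩
    obtain ⟨c, hcA, hcB⟩ := h
    have hle := hmin c hcA c hcB
    rw [(hd c c).2 rfl] at hle
    obtain rfl := (hd a b).1 (le_antisymm hle (hz _))
    exact ⟨ha, hb⟩
  · rintro ⟨hbA, hbB⟩
    refine ⟨hbB, b, hbA, fun a' _ b' _ => ?_⟩
    rw [(hd b b).2 rfl]
    exact hz _

/-- The basic comparison between distances: `(A, B)` is related to `(B, C)` when `op` shows
that `A` is at most as far from `B` as `C` is. -/
def DistStep {U : Type*} {Y : Set (Set U)} (op : Set U → Set U → Set U) (p q : Y × Y) : Prop :=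
  p.2 = q.1 ∧ (op p.2 (p.1 ∪ q.2) ∩ p.1).Nonempty

/-- The comparison of distances between sets forced by `op`. -/
def DistLE {U : Type*} {Y : Set (Set U)} (op : Set U → Set U → Set U) : Y × Y → Y × Y → Prop :=
  Relation.ReflTransGen (DistStep op)

theorem DistLE.trans {U : Type*} {Y : Set (Set U)} {op : Set U → Set U → Set U} {p q r : Y × Y}
    (h : DistLE op p q) (h' : DistLE op q r) : DistLE op p r :=
  Relation.ReflTransGen.trans h h'

theorem DistLE.of_step {U : Type*} {Y : Set (Set U)} {op : Set U → Set U → Set U} {A B C : Y}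
    (h : (op B (A ∪ C) ∩ A).Nonempty) : DistLE op (A, B) (B, C) :=
  Relation.ReflTransGen.single ⟨rfl, h⟩

section Comparison

variable {U : Type*} {Y : Set (Set U)} {op : Set U → Set U → Set U}

/-- The loop condition says that the comparison of distances from a common set is decided
by `op`. -/
theorem LoopCond.inter_nonempty (hloop : LoopCond Y op)
    (hself : ∀ A ∈ Y, (op A (A ∪ A) ∩ A).Nonempty) {A B C : Y}
    (h : DistLE op (A, C) (B, A)) : (op A (B ∪ C) ∩ C).Nonempty := by
  obtain ⟨n, f, h0, hn, hf⟩ := h.exists_seq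
  rcases Nat.eq_zero_or_pos n with rfl | hpos
  · obtain ⟨hAB, hCA⟩ := Prod.mk.inj (h0.symm.trans hn)
    rw [← hAB, hCA]
    exact hself _ A.2
  · have key := hloop n (fun i => (f i).1) hpos (fun i _ => (f i).1.2) ?_ ?_
    · have h1 := (hf 0 hpos).1
      simpa [h0, hn, ← h1] using key
    · intro i hi hin
      obtain ⟨j, rfl⟩ : ∃ j, i = j + 1 := ⟨i - 1, by omega⟩
      have hj := hf j (by omega)
      have hj' := (hf (j + 1) hin).1
      simpa [DistStep, hj', hj.1] using hj.2
    · obtain ⟨j, rfl⟩ : ∃ j, n = j + 1 := ⟨n - 1, by omega⟩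
      have hj := hf j (by omega)
      have h2 : (f (j + 1)).2 = (f 0).1 := by rw [h0, hn]
      simpa [DistStep, ← h2, hj.1] using hj.2

theorem DistLE.of_subset (hY0 : ∅ ∉ Y) (hop : ∀ A ∈ Y, ∀ B ∈ Y, op A B ∈ Y)
    (hsub : ∀ A ∈ Y, ∀ B ∈ Y, op A B ⊆ B) {A B C : Y} (h : (C : Set U) ⊆ B) :
    DistLE op (B, A) (A, C) := by
  refine .of_step ?_
  rw [Set.union_eq_self_of_subset_right h,
    Set.inter_eq_self_of_subset_left (hsub _ A.2 _ B.2)]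
  exact Set.nonempty_iff_ne_empty.2 fun h => hY0 (h ▸ hop _ A.2 _ B.2)

end Comparison

/-- Proposition 2.2 (b): `op` is representable by an identity-respecting symmetric
pseudo-distance iff it satisfies (|1), (|2) and the Loop condition (|S1). -/
theorem representable_id_symmetric_iff {U : Type} [Nonempty U] (Y : Set (Set U))
    (hY0 : ∅ ∉ Y) (hYsingle : ∀ a : U, {a} ∈ Y)
    (hYinter : ∀ A ∈ Y, ∀ B ∈ Y, (A ∩ B).Nonempty → A ∩ B ∈ Y)
    (hYunion : ∀ A ∈ Y, ∀ B ∈ Y, A ∪ B ∈ Y)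
    (op : Set U → Set U → Set U)
    (hop : ∀ A ∈ Y, ∀ B ∈ Y, op A B ∈ Y) :
    (∃ (Z : Type) (_ : LinearOrder Z) (d : U → U → Z),
        (∀ a b : U, d a b = d b a) ∧
        (∃ z0 : Z, (∀ z : Z, z0 ≤ z) ∧ ∀ a b : U, d a b = z0 ↔ a = b) ∧
        ∀ A ∈ Y, ∀ B ∈ Y, op A B = distRev d A B) ↔
      ((∀ A ∈ Y, ∀ B ∈ Y, op A B ⊆ B) ∧
       (∀ A ∈ Y, ∀ B ∈ Y, (A ∩ B).Nonempty → op A B = A ∩ B) ∧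
       LoopCond Y op) := by
  constructor
  · rintro ⟨Z, _, d, hsymm, ⟨z0, hz, hd⟩, hrep⟩
    refine ⟨fun A hA B hB => ?_, fun A hA B hB h => ?_,
      loopCond_of_representable hYunion hsymm hrep⟩
    · rw [hrep A hA B hB]
      exact fun b hb => hb.1
    · rw [hrep A hA B hB]
      exact distRev_eq_inter hz hd h
  · rintro ⟨hsub, hint, hloop⟩
    have hne : ∀ A ∈ Y, A.Nonempty := fun A hA =>
      Set.nonempty_iff_ne_empty.2 fun h => hY0 (h ▸ hA)
    have hself : ∀ A ∈ Y, (op A (A ∪ A) ∩ A).Nonempty := fun A hA => by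
      rw [Set.union_self, Set.inter_eq_self_of_subset_left (hsub A hA A hA)]
      exact hne _ (hop A hA A hA)
    have hmono : ∀ {A B C : Y}, (C : Set U) ⊆ B → DistLE op (B, A) (A, C) :=
      DistLE.of_subset hY0 hop hsub
    have hflip : ∀ A B : Y, DistLE op (A, B) (B, A) := fun A B => hmono subset_rfl
    have hmeet : ∀ {A B C : Y} (x : U), x ∈ (A : Set U) → x ∈ (B : Set U) →
        DistLE op (A, B) (B, C) := fun {A B C} x hA hB => .of_step <| by
      have hx : x ∈ (B : Set U) ∩ (A ∪ C) := ⟨hB, Or.inl hA⟩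
      rw [hint _ B.2 _ (hYunion _ A.2 _ C.2) ⟨x, hx⟩]
      exact ⟨x, hx, hA⟩
    let s : U → Y := fun a => ⟨{a}, hYsingle a⟩
    have hmem : ∀ a, a ∈ (s a : Set U) := fun a => rfl
    have hpoints : ∀ {A B : Y} {a b : U}, a ∈ (A : Set U) → b ∈ (B : Set U) →
        DistLE op (A, B) (s a, s b) := fun {A B a b} ha hb =>
      (hmono (C := s a) (Set.singleton_subset_iff.2 ha)).trans
        ((hflip _ _).trans ((hflip _ _).trans (hmono (Set.singleton_subset_iff.2 hb))))
    have hclosest : ∀ {A B : Y} {b : U}, b ∈ op A B →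
        ∃ a ∈ (A : Set U), DistLE op (s a, s b) (A, B) := fun {A B b} hb => by
      obtain ⟨a, ha⟩ := hne _ (hop _ (s b).2 _ A.2)
      have haA := hsub _ (s b).2 _ A.2 ha
      refine ⟨a, haA, .trans (.of_step (C := A) ⟨a, ?_, rfl⟩) (.of_step ⟨b, ?_, rfl⟩)⟩
      · rwa [Set.union_eq_self_of_subset_left (Set.singleton_subset_iff.2 haA)]
      · rwa [Set.union_eq_self_of_subset_left
          (Set.singleton_subset_iff.2 (hsub _ A.2 _ B.2 hb))]
    have hdiag : ∀ a (p : Y × Y), DistLE op (s a, s a) p := by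
      rintro a ⟨A, B⟩
      obtain ⟨x, hx⟩ := hne _ A.2
      let P : Y := ⟨{a} ∪ {x}, hYunion _ (hYsingle a) _ (hYsingle x)⟩
      have haP : a ∈ (P : Set U) := Or.inl rfl
      have hxP : x ∈ (P : Set U) := Or.inr rfl
      exact (hmeet (C := P) a (hmem a) (hmem a)).trans
        ((hmeet (C := s x) a (hmem a) haP).trans
          ((hmeet (C := A) x hxP (hmem x)).trans (hmeet x (hmem x) hx)))
    obtain ⟨Z, _, f, hsurj, hf, hf'⟩ := exists_linearOrder_extension (DistLE op (Y := Y))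
      (fun _ => Relation.ReflTransGen.refl) (fun _ _ _ => DistLE.trans)
    refine ⟨Z, inferInstance, fun a b => f (s a, s b),
      fun a b => le_antisymm (hf _ _ (hflip _ _)) (hf _ _ (hflip _ _)), ?_, ?_⟩
    · obtain ⟨o⟩ := ‹Nonempty U›
      refine ⟨f (s o, s o), fun z => ?_, fun a b => ⟨fun h => ?_, ?_⟩⟩
      · obtain ⟨p, rfl⟩ := hsurj z
        exact hf _ _ (hdiag o p)
      · obtain ⟨x, hx, hxb⟩ := hloop.inter_nonempty hself
          ((hf' _ _ h).trans (hdiag o (s a, s a)))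
        have hxa : a ∈ (s a : Set U) ∩ (s a ∪ s b) := ⟨rfl, Or.inl rfl⟩
        rw [hint _ (s a).2 _ (hYunion _ (s a).2 _ (s b).2) ⟨a, hxa⟩] at hx
        exact (Set.mem_singleton_iff.1 hx.1).symm.trans hxb
      · rintro rfl
        exact le_antisymm (hf _ _ (hdiag a _)) (hf _ _ (hdiag o _))
    · intro A hA B hB
      ext b
      constructor
      · intro hb
        obtain ⟨a, ha, hab⟩ := hclosest (A := ⟨A, hA⟩) (B := ⟨B, hB⟩) hb
        exact ⟨hsub A hA B hB hb, a, ha,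
          fun a' ha' b' hb' => hf _ _ (hab.trans (hpoints ha' hb'))⟩
      · rintro ⟨hb, a, ha, hmin⟩
        obtain ⟨c, hc⟩ := hne _ (hop A hA B hB)
        obtain ⟨a', ha', hle⟩ := hclosest (A := ⟨A, hA⟩) (B := ⟨B, hB⟩) hc
        have heq : f (s a, s b) = f (⟨A, hA⟩, ⟨B, hB⟩) :=
          le_antisymm ((hmin a' ha' c (hsub A hA B hB hc)).trans (hf _ _ hle))
            (hf _ _ (hpoints ha hb))
        obtain ⟨x, hx, hxb⟩ := hloop.inter_nonempty hself
          ((hpoints (A := ⟨A, hA⟩) (B := s b) ha (hmem b)).trans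
            ((hf' _ _ heq).trans (hflip _ _)))
        obtain rfl := Set.mem_singleton_iff.1 hxb
        rwa [Set.union_eq_self_of_subset_right (Set.singleton_subset_iff.2 hb)] at hx
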